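/- arXiv:1110.3371 — 4 statements merged into one kernel-verified Lean document; each statement's English description precedes it below -/
import Mathlib

section
/- Let α, A_1, A_2 ∈ (0,∞) and let x_n, y_n, z_n be positive sequences with x_0, y_0, z_0 ∈ (0,∞) satisfying x_{n+1} = (x_n + y_n)/(A_1 z_n + x_n + y_n), y_{n+1} = (x_n + y_n)/(A_2 z_n + x_n + y_n), z_{n+1} = (α z_n + x_n + y_n)/(x_n + y_n) for n ≥ 0. Define w_n = (x_n + y_n)/z_n. Then for all n ≥ 0, w_{n+1} = (w_n²/(α + w_n)) · (1/(A_1 + w_n) + 1/(A_2 + w_n)); moreover x_{n+1} = 1/(A_1/w_n + 1), y_{n+1} = 1/(A_2/w_n + 1), and z_{n+1} = 1 + α/w_n for all n ≥ 0. -/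
/-- The change of variables `w n = (x n + y n) / z n` for the
homogeneous-type system of three rational difference equations yields a first
order scalar recurrence, and the original variables are recovered from `w`. -/
theorem homogeneous_three_system_reduction (α A₁ A₂ : ℝ)
    (hα : 0 < α) (hA₁ : 0 < A₁) (hA₂ : 0 < A₂)
    (x y z : ℕ → ℝ)
    (hx : ∀ n, 0 < x n) (hy : ∀ n, 0 < y n) (hz : ∀ n, 0 < z n)
    (hxrec : ∀ n, x (n + 1) = (x n + y n) / (A₁ * z n + x n + y n))
    (hyrec : ∀ n, y (n + 1) = (x n + y n) / (A₂ * z n + x n + y n))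
    (hzrec : ∀ n, z (n + 1) = (α * z n + x n + y n) / (x n + y n))
    (w : ℕ → ℝ) (hw : ∀ n, w n = (x n + y n) / z n) :
    ∀ n, w (n + 1) = w n ^ 2 / (α + w n) * (1 / (A₁ + w n) + 1 / (A₂ + w n)) ∧
      x (n + 1) = 1 / (A₁ / w n + 1) ∧
      y (n + 1) = 1 / (A₂ / w n + 1) ∧
      z (n + 1) = 1 + α / w n := by
  intro n
  have hzn := hz n
  have hwpos : 0 < w n := by
    rw [hw]; exact div_pos (add_pos (hx n) (hy n)) hzn
  have hs : x n + y n = w n * z n := by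
    rw [hw]; field_simp
  have h1 : x (n + 1) = w n / (A₁ + w n) := by
    rw [hxrec, add_assoc, hs, ← add_mul, mul_div_mul_right _ _ hzn.ne']
  have h2 : y (n + 1) = w n / (A₂ + w n) := by
    rw [hyrec, add_assoc, hs, ← add_mul, mul_div_mul_right _ _ hzn.ne']
  have h3 : z (n + 1) = (α + w n) / w n := by
    rw [hzrec, add_assoc, hs, ← add_mul, mul_div_mul_right _ _ hzn.ne']
  have e1 : A₁ + w n ≠ 0 := by positivity
  have e2 : A₂ + w n ≠ 0 := by positivity
  have e3 : α + w n ≠ 0 := by positivity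
  refine ⟨?_, ?_, ?_, ?_⟩
  · rw [hw (n + 1), h1, h2, h3]
    field_simp
  · rw [h1]; field_simp
  · rw [h2]; field_simp
  · rw [h3]; field_simp; ring
end

section
/- Let A, B, C, D ∈ (0,∞) and let x_n, y_n, z_n be positive sequences with x_0, y_0, z_0 ∈ (0,∞) satisfying x_{n+1} = 1/(A z_n + B y_n), y_{n+1} = 1/(C z_n + D x_n), z_{n+1} = 1/z_n for n ≥ 0. Then z_{2n} = z_0 and z_{2n+1} = 1/z_0 for all n ≥ 0, and the sequence u_n = x_n/z_n satisfies u_{n+1} = (C + D u_{n−1})/(AC + AD u_{n−1} + B) for all n ≥ 1. -/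
/-- For the hyperbolic-type system with `z_{n+1} = 1/z_n`, the
sequence `z` is 2-periodic and `u n = x n / z n` satisfies a second order
rational difference equation. -/
theorem hyperbolic_period_two_system_reduction (A B C D : ℝ)
    (hA : 0 < A) (hB : 0 < B) (hC : 0 < C) (hD : 0 < D)
    (x y z : ℕ → ℝ)
    (hx : ∀ n, 0 < x n) (hy : ∀ n, 0 < y n) (hz : ∀ n, 0 < z n)
    (hxrec : ∀ n, x (n + 1) = 1 / (A * z n + B * y n))
    (hyrec : ∀ n, y (n + 1) = 1 / (C * z n + D * x n))
    (hzrec : ∀ n, z (n + 1) = 1 / z n)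
    (u : ℕ → ℝ) (hu : ∀ n, u n = x n / z n) :
    (∀ n, z (2 * n) = z 0 ∧ z (2 * n + 1) = 1 / z 0) ∧
      ∀ n, 1 ≤ n →
        u (n + 1) = (C + D * u (n - 1)) / (A * C + A * D * u (n - 1) + B) := by
  have h2 : ∀ n, z (n + 1 + 1) = z n := fun n => by
    rw [hzrec, hzrec, one_div_one_div]
  refine ⟨?_, ?_⟩
  · have h0 : ∀ n, z (2 * n) = z 0 := by
      intro n
      induction n with
      | zero => rfl
      | succ k ih =>
        have h := h2 (2 * k)
        rw [ih] at h
        exact h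
    exact fun n => ⟨h0 n, by rw [hzrec, h0 n]⟩
  · intro n hn
    obtain ⟨m, rfl⟩ : ∃ m, n = m + 1 := ⟨n - 1, by omega⟩
    rw [Nat.add_sub_cancel, hu (m + 1 + 1), hu m, h2, hxrec, hzrec, hyrec]
    have hzm := hz m
    have hxm := hx m
    generalize z m = c at *
    generalize x m = a at *
    have e1 : 0 < C * c + D * a := by positivity
    have e2 : 0 < A * (C * c + D * a) + B * c := by positivity
    have l : 1 / (A * (1 / c) + B * (1 / (C * c + D * a))) / c
        = (C * c + D * a) / (A * (C * c + D * a) + B * c) := by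
      have : A * (1 / c) + B * (1 / (C * c + D * a))
          = (A * (C * c + D * a) + B * c) / (c * (C * c + D * a)) := by
        field_simp
      rw [this]
      field_simp
    have r1 : C + D * (a / c) = (C * c + D * a) / c := by field_simp
    have r2 : A * C + A * D * (a / c) + B = (A * (C * c + D * a) + B * c) / c := by
      field_simp
    rw [l, r1, r2, div_div_div_cancel_right₀ hzm.ne']
end

section
/- Let A, B, C, D ∈ (0,∞) and let u_n be a sequence of positive reals satisfying u_{n+1} = (C + D u_{n−1})/(AC + AD u_{n−1} + B) for all n ≥ 1, with u_0, u_1 ∈ (0,∞). Then u_n converges to ū = (D − AC − B + √((D − AC − B)² + 4ADC))/(2AD). -/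
/-- The second order rational difference equation
`u_{n+1} = (C + D u_{n-1}) / (AC + AD u_{n-1} + B)` with positive parameters
and positive initial conditions converges to its unique positive equilibrium. -/
theorem second_order_decoupled_riccati_convergence (A B C D : ℝ)
    (hA : 0 < A) (hB : 0 < B) (hC : 0 < C) (hD : 0 < D)
    (u : ℕ → ℝ) (hu : ∀ n, 0 < u n)
    (hrec : ∀ n, 1 ≤ n →
      u (n + 1) = (C + D * u (n - 1)) / (A * C + A * D * u (n - 1) + B)) :
    Filter.Tendsto u Filter.atTop (nhds
      ((D - A * C - B +
          Real.sqrt ((D - A * C - B) ^ 2 + 4 * A * D * C)) / (2 * A * D))) := by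
  set s := Real.sqrt ((D - A * C - B) ^ 2 + 4 * A * D * C) with hs
  have hADC : 0 < 4 * A * D * C := by positivity
  have hsq : s ^ 2 = (D - A * C - B) ^ 2 + 4 * A * D * C :=
    Real.sq_sqrt (by positivity)
  have hs0 : 0 ≤ s := Real.sqrt_nonneg _
  have hAD : 0 < A * D := by positivity
  set L := (D - A * C - B + s) / (2 * A * D) with hL
  have hLs : 2 * A * D * L - (D - A * C - B) = s := by
    rw [hL]; field_simp; ring
  have hLpos : 0 < L := by
    apply div_pos _ (by positivity)
    by_contra h
    nlinarith
  have hfix : L * (A * C + A * D * L + B) = C + D * L := by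
    rw [← hLs] at hsq
    have : (4 * (A * D)) * (L * (A * C + A * D * L + B) - (C + D * L)) = 0 := by
      linear_combination hsq
    rcases mul_eq_zero.mp this with h | h
    · linarith
    · linarith
  have hAC : 0 < A * C := by positivity
  have hQ : 0 < A * C + A * D * L + B := by positivity
  have hDQ : D ≤ A * C + A * D * L + B := by
    by_contra h
    push Not at h
    nlinarith [mul_lt_mul_of_pos_left h hLpos]
  set k := B / (A * C + B) with hk
  have hk0 : 0 ≤ k := by positivity
  have hk1 : k < 1 := by rw [hk, div_lt_one (by positivity)]; linarith
  have hstep : ∀ n, |u (n + 2) - L| ≤ k * |u n - L| := by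
    intro n
    have h := hrec (n + 1) (by omega)
    simp only [Nat.add_sub_cancel] at h
    have hun := hu n
    have hP : 0 < A * C + A * D * u n + B := by positivity
    have e : u (n + 2) - L = (D / (A * C + A * D * L + B)) *
        (B / (A * C + A * D * u n + B)) * (u n - L) := by
      have hL2 : L = (C + D * L) / (A * C + A * D * L + B) := by
        rw [eq_div_iff hQ.ne']; exact hfix
      have h2 : u (n + 2) - L = (C + D * u n) / (A * C + A * D * u n + B)
          - (C + D * L) / (A * C + A * D * L + B) := by
        rw [← hL2, ← h]
      rw [h2, div_sub_div _ _ hP.ne' hQ.ne', div_mul_div_comm, div_mul_eq_mul_div,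
        mul_comm (A * C + A * D * L + B)]
      congr 1
      ring
    rw [e, abs_mul, abs_of_nonneg (by positivity)]
    apply mul_le_mul_of_nonneg_right _ (abs_nonneg _)
    have h1 : D / (A * C + A * D * L + B) ≤ 1 := (div_le_one hQ).2 hDQ
    have h2 : B / (A * C + A * D * u n + B) ≤ k := by
      apply div_le_div_of_nonneg_left hB.le (by positivity)
      have : 0 < A * D * u n := by positivity
      linarith
    calc _ ≤ 1 * k := mul_le_mul h1 h2 (by positivity) (by norm_num)
      _ = k := one_mul k
  have hbd : ∀ n, |u n - L| ≤ (|u 0 - L| + |u 1 - L|) * k ^ (n / 2) := by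
    intro n
    induction n using Nat.strong_induction_on with
    | _ n ih =>
      match n, ih with
      | 0, _ => simp
      | 1, _ => simp
      | m + 2, ih =>
        have h := mul_le_mul_of_nonneg_left (ih m (by omega)) hk0
        have e : (m + 2) / 2 = m / 2 + 1 := by omega
        rw [e, pow_succ]
        linarith [hstep m]
  have hlim : Filter.Tendsto (fun n : ℕ => (|u 0 - L| + |u 1 - L|) * k ^ (n / 2))
      Filter.atTop (nhds 0) := by
    have h := ((tendsto_pow_atTop_nhds_zero_of_lt_one hk0 hk1).comp
      (Nat.tendsto_div_const_atTop (n := 2) (by norm_num))).const_mul (|u 0 - L| + |u 1 - L|)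
    simpa using h
  rw [tendsto_iff_dist_tendsto_zero]
  exact squeeze_zero (fun _ => dist_nonneg) (fun n => by rw [Real.dist_eq]; exact hbd n) hlim
end

section
/- Let A, B, C, D ∈ (0,∞) and let x_n, y_n, z_n be positive sequences with x_0, y_0, z_0 ∈ (0,∞) satisfying x_{n+1} = 1/(A z_n + B y_n), y_{n+1} = 1/(C z_n + D x_n), z_{n+1} = 1/z_n for n ≥ 0. Set R = √((D − AC − B)² + 4ADC). Then z_{2n} = z_0 and z_{2n+1} = 1/z_0 for all n, and as n → ∞: x_{2n} → z_0 (D − AC − B + R)/(2AD), x_{2n+1} → (D − AC − B + R)/(2AD z_0), y_{2n} → z_0 · 2A/(AC + D − B + R), and y_{2n+1} → 2A/(z_0 (AC + D − B + R)). In other words, every solution converges to the stated (not necessarily prime) period-2 solution. -/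
open Filter Topology in
theorem aux_geom (s : ℕ → ℝ) (a q : ℝ) (h0 : 0 ≤ q) (h1 : q < 1)
    (h : ∀ n, |s (n + 1) - a| ≤ q * |s n - a|) : Tendsto s atTop (𝓝 a) := by
  have hb : ∀ n, |s n - a| ≤ q ^ n * |s 0 - a| := by
    intro n
    induction n with
    | zero => simp
    | succ k ih =>
      calc _ ≤ q * |s k - a| := h k
        _ ≤ q * (q ^ k * |s 0 - a|) := by gcongr
        _ = _ := by ring
  rw [tendsto_iff_dist_tendsto_zero]
  have hl : Tendsto (fun n => q ^ n * |s 0 - a|) atTop (𝓝 0) := by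
    simpa using (tendsto_pow_atTop_nhds_zero_of_lt_one h0 h1).mul_const |s 0 - a|
  exact squeeze_zero (fun n => dist_nonneg) (fun n => by rw [Real.dist_eq]; exact hb n) hl

theorem aux_step (A B C D a u : ℝ) (hA : 0 < A) (hB : 0 < B) (hC : 0 < C) (hD : 0 < D)
    (ha : 0 < a) (hu : 0 < u) (hfix : A * D * a ^ 2 + (A * C + B - D) * a - C = 0) :
    |1 / (A + B * (1 / (C + D * u))) - a| ≤
      (B * D / ((A * C + B) * (A * C + B + A * D * a))) * |u - a| := by
  have e : 1 / (A + B * (1 / (C + D * u))) - a =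
      (B * D / ((A * C + B + A * D * u) * (A * C + B + A * D * a))) * (u - a) := by
    have h1 : 1 / (A + B * (1 / (C + D * u))) = (C + D * u) / (A * C + B + A * D * u) := by
      have : 0 < C + D * u := by positivity
      have : 0 < A * C + B + A * D * u := by positivity
      have : 0 < A + B * (1 / (C + D * u)) := by positivity
      rw [div_eq_div_iff (by positivity) (by positivity)]
      field_simp
      ring
    have h2 : a = (C + D * a) / (A * C + B + A * D * a) := by
      rw [eq_div_iff (by positivity)]
      linarith
    rw [h1]
    calc _ = (C + D * u) / (A * C + B + A * D * u) - (C + D * a) / (A * C + B + A * D * a) := by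
          rw [← h2]
      _ = _ := by
          have : 0 < A * C + B + A * D * u := by positivity
          have : 0 < A * C + B + A * D * a := by positivity
          rw [div_sub_div _ _ (by positivity) (by positivity), div_mul_eq_mul_div]
          congr 1
          ring
  rw [e, abs_mul, abs_of_pos (by positivity)]
  have h0 : 0 < A * D * u := by positivity
  have h3 : A * C + B ≤ A * C + B + A * D * u := by linarith
  refine mul_le_mul_of_nonneg_right ?_ (abs_nonneg _)
  refine div_le_div_of_nonneg_left (by positivity) (by positivity) ?_
  exact mul_le_mul_of_nonneg_right h3 (by positivity)

/-- Every solution of the hyperbolic-type system with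
`z_{n+1} = 1/z_n` converges to a (not necessarily prime) period-2 solution. -/
theorem hyperbolic_period_two_system_convergence (A B C D : ℝ)
    (hA : 0 < A) (hB : 0 < B) (hC : 0 < C) (hD : 0 < D)
    (x y z : ℕ → ℝ)
    (hx : ∀ n, 0 < x n) (hy : ∀ n, 0 < y n) (hz : ∀ n, 0 < z n)
    (hxrec : ∀ n, x (n + 1) = 1 / (A * z n + B * y n))
    (hyrec : ∀ n, y (n + 1) = 1 / (C * z n + D * x n))
    (hzrec : ∀ n, z (n + 1) = 1 / z n)
    (R : ℝ) (hR : R = Real.sqrt ((D - A * C - B) ^ 2 + 4 * A * D * C)) :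
    (∀ n, z (2 * n) = z 0 ∧ z (2 * n + 1) = 1 / z 0) ∧
      Filter.Tendsto (fun n => x (2 * n)) Filter.atTop
        (nhds (z 0 * ((D - A * C - B + R) / (2 * A * D)))) ∧
      Filter.Tendsto (fun n => x (2 * n + 1)) Filter.atTop
        (nhds ((D - A * C - B + R) / (2 * A * D * z 0))) ∧
      Filter.Tendsto (fun n => y (2 * n)) Filter.atTop
        (nhds (z 0 * (2 * A / (A * C + D - B + R)))) ∧
      Filter.Tendsto (fun n => y (2 * n + 1)) Filter.atTop
        (nhds (2 * A / (z 0 * (A * C + D - B + R)))) := by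
  have hzn : ∀ n, z (2 * n) = z 0 ∧ z (2 * n + 1) = 1 / z 0 := by
    intro n
    induction n with
    | zero => exact ⟨rfl, hzrec 0⟩
    | succ k ih =>
      have h1 : z (2 * (k + 1)) = z 0 := by
        rw [show 2 * (k + 1) = 2 * k + 1 + 1 by ring, hzrec, ih.2, one_div_one_div]
      exact ⟨h1, by rw [hzrec, h1]⟩
  have hz0 := hz 0
  have hu : ∀ n, x (n + 1) / z (n + 1) = 1 / (A + B * (y n / z n)) := by
    intro n
    have := hz n
    have := hy n
    rw [hxrec, hzrec]
    field_simp
  have hv : ∀ n, y (n + 1) / z (n + 1) = 1 / (C + D * (x n / z n)) := by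
    intro n
    have := hz n
    have := hx n
    rw [hyrec, hzrec]
    field_simp
  have hR2 : R ^ 2 = (D - A * C - B) ^ 2 + 4 * A * D * C := by
    rw [hR, Real.sq_sqrt (by positivity)]
  have hR0 : 0 ≤ R := by rw [hR]; exact Real.sqrt_nonneg _
  have hp : 0 < A * D * C := by positivity
  have hnum : 0 < D - A * C - B + R := by
    have : |D - A * C - B| < R := abs_lt_of_sq_lt_sq (by linarith) hR0
    linarith [(abs_lt.mp this).1]
  obtain ⟨a, ha⟩ : ∃ a, a = (D - A * C - B + R) / (2 * A * D) := ⟨_, rfl⟩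
  have ha0 : 0 < a := by rw [ha]; positivity
  have haR : R = 2 * A * D * a - (D - A * C - B) := by
    rw [ha]; field_simp; ring
  have hfix : A * D * a ^ 2 + (A * C + B - D) * a - C = 0 := by
    rw [haR] at hR2
    have : 4 * (A * D) * (A * D * a ^ 2 + (A * C + B - D) * a - C) = 0 := by linarith
    rcases mul_eq_zero.mp this with h | h
    · have : 0 < 4 * (A * D) := by positivity
      linarith
    · exact h
  have hb : 2 * A / (A * C + D - B + R) = 1 / (C + D * a) := by
    rw [haR, div_eq_div_iff]
    · ring
    · have : 0 < A * C + A * D * a := by positivity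
      nlinarith
    · positivity
  have hq1 : B * D / ((A * C + B) * (A * C + B + A * D * a)) < 1 := by
    have hlt : D < A * C + B + A * D * a := by
      by_contra hcon
      push Not at hcon
      have := mul_le_mul_of_nonneg_right hcon ha0.le
      nlinarith
    rw [div_lt_one (by positivity)]
    have : 0 < A * C := by positivity
    apply mul_lt_mul'' (by linarith) hlt hB.le hD.le
  have hstep : ∀ n, |x (n + 2) / z (n + 2) - a| ≤
      (B * D / ((A * C + B) * (A * C + B + A * D * a))) * |x n / z n - a| := by
    intro n
    rw [hu (n + 1), hv n]
    exact aux_step A B C D a _ hA hB hC hD ha0 (div_pos (hx n) (hz n)) hfix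
  have he := aux_geom (fun n => x (2 * n) / z (2 * n)) a _ (by positivity) hq1
    (fun n => hstep (2 * n))
  have ho := aux_geom (fun n => x (2 * n + 1) / z (2 * n + 1)) a _ (by positivity) hq1
    (fun n => hstep (2 * n + 1))
  have hne : C + D * a ≠ 0 := by positivity
  have hvo : Filter.Tendsto (fun n => y (2 * n + 1) / z (2 * n + 1)) Filter.atTop
      (nhds (1 / (C + D * a))) := by
    simp only [hv]
    exact tendsto_const_nhds.div (tendsto_const_nhds.add (he.const_mul D)) hne
  have hve : Filter.Tendsto (fun n => y (2 * n) / z (2 * n)) Filter.atTop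
      (nhds (1 / (C + D * a))) := by
    rw [← Filter.tendsto_add_atTop_iff_nat 1]
    have h2 : (fun n => y (2 * (n + 1)) / z (2 * (n + 1))) =
        fun n => 1 / (C + D * (x (2 * n + 1) / z (2 * n + 1))) := by
      funext n
      exact hv (2 * n + 1)
    rw [h2]
    exact tendsto_const_nhds.div (tendsto_const_nhds.add (ho.const_mul D)) hne
  have ee : ∀ (w : ℕ → ℝ) (l : ℝ),
      Filter.Tendsto (fun n => w (2 * n) / z (2 * n)) Filter.atTop (nhds l) →
      Filter.Tendsto (fun n => w (2 * n)) Filter.atTop (nhds (z 0 * l)) := by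
    intro w l h
    refine (h.const_mul (z 0)).congr fun n => ?_
    rw [(hzn n).1]
    field_simp
  have eo : ∀ (w : ℕ → ℝ) (l : ℝ),
      Filter.Tendsto (fun n => w (2 * n + 1) / z (2 * n + 1)) Filter.atTop (nhds l) →
      Filter.Tendsto (fun n => w (2 * n + 1)) Filter.atTop (nhds (1 / z 0 * l)) := by
    intro w l h
    refine (h.const_mul (1 / z 0)).congr fun n => ?_
    rw [(hzn n).2]
    field_simp
  refine ⟨hzn, ?_, ?_, ?_, ?_⟩
  · rw [← ha]; exact ee x a he
  · have := eo x a ho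
    rwa [ha, div_mul_div_comm, one_mul, mul_comm (z 0)] at this
  · rw [hb]; exact ee y _ hve
  · have := eo y _ hvo
    rwa [← hb, div_mul_div_comm, one_mul] at this
end
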